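/- Let M_t = ∫_0^t f(s) dW_s be a continuous martingale with [M]_t = ∫_0^t f(s)² ds, and suppose E|M_T|³ < ∞ and E[(∫_0^T f²ds)^{3/2}] < ∞. Then E[M_T · ∫_0^T f(s)² ds] = (1/3) E[M_T³], and consequently E[(∫_0^T f²(s)ds)(∫_0^T f(s)dW_s)] can be bounded: |E[M_T [M]_T]| ≤ √(E[[M]_T²]) · √(E[[M]_T]). -/

import Mathlib

open MeasureTheory

theorem MeasureTheory.Martingale.integral_mul_sub_eq_zero {Ω ι : Type*} [Preorder ι]
    {mΩ : MeasurableSpace Ω} {P : Measure Ω} [IsFiniteMeasure P] {ℱ : Filtration ι mΩ}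
    {X : ι → Ω → ℝ} (hX : Martingale X ℱ P) {i j : ι} (hij : i ≤ j) {w : Ω → ℝ}
    (hw : StronglyMeasurable[ℱ i] w) (hint : Integrable (fun ω => w ω * (X j ω - X i ω)) P) :
    ∫ ω, w ω * (X j ω - X i ω) ∂P = 0 := by
  have hsub : Integrable (X j - X i) P := (hX.integrable j).sub (hX.integrable i)
  have hint' : Integrable (w * (X j - X i)) P := hint
  have h1 : P[w * (X j - X i) | ℱ i] =ᵐ[P] 0 := by
    refine (condExp_mul_of_stronglyMeasurable_left hw hint' hsub).trans ?_
    filter_upwards [condExp_sub (hX.integrable j) (hX.integrable i) (ℱ i), hX.2 i j hij,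
      hX.2 i i le_rfl] with ω h h' h''
    rw [Pi.mul_apply, h, Pi.sub_apply, h', h'', sub_self, mul_zero, Pi.zero_apply]
  calc ∫ ω, w ω * (X j ω - X i ω) ∂P = ∫ ω, (P[w * (X j - X i) | ℱ i]) ω ∂P :=
        (integral_condExp (ℱ.le i)).symm
    _ = 0 := by rw [integral_congr_ae h1]; simp

/-- Sampling a martingale along a monotone sequence of times. -/
theorem MeasureTheory.Martingale.comp_monotone {Ω ι κ : Type*} [Preorder ι] [Preorder κ]
    {mΩ : MeasurableSpace Ω} {P : Measure Ω} {ℱ : Filtration ι mΩ}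
    {X : ι → Ω → ℝ} (hX : Martingale X ℱ P) {t : κ → ι} (ht : Monotone t) :
    Martingale (fun k => X (t k))
      (⟨fun k => ℱ (t k), fun _ _ h => ℱ.mono (ht h), fun k => ℱ.le (t k)⟩ : Filtration κ mΩ) P :=
  ⟨fun k => hX.1 (t k), fun _ _ h => hX.2 _ _ (ht h)⟩

theorem stronglyMeasurable_partialSups {Ω : Type*} {mΩ : MeasurableSpace Ω}
    {𝒢 : Filtration ℕ mΩ} {X : ℕ → Ω → ℝ} (hX : StronglyAdapted 𝒢 X) (n : ℕ) :
    StronglyMeasurable[𝒢 n] (fun ω => partialSups (fun k => X k ω) n) := by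
  induction n with
  | zero => simpa using hX 0
  | succ n ih =>
    simp only [partialSups_add_one]
    exact ((ih.mono (𝒢.mono n.le_succ)).measurable.max (hX (n + 1)).measurable).stronglyMeasurable

/-- Pathwise form of Doob's maximal inequality with exponent `3/2`. -/
theorem sqrt_partialSups_pow_three_add_sum_le {x : ℕ → ℝ} (hx : ∀ k, 0 ≤ x k) (n : ℕ) :
    √(partialSups x n) ^ 3 + 3 * ∑ k ∈ Finset.range n, √(partialSups x k) * (x (k + 1) - x k) ≤
      3 * (√(partialSups x n) * x n) := by
  induction n with
  | zero =>
    have h := Real.sqrt_nonneg (x 0)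
    have h' := Real.sq_sqrt (hx 0)
    have h3 : √(x 0) * x 0 = √(x 0) ^ 3 := by nth_rewrite 2 [← h']; ring
    simp only [partialSups_zero, Finset.range_zero, Finset.sum_empty, h3]
    nlinarith [pow_nonneg h 3]
  | succ n ih =>
    rw [Finset.sum_range_succ, partialSups_add_one]
    rcases le_total (x (n + 1)) (partialSups x n) with h | h
    · rw [sup_eq_left.2 h]
      linarith
    · rw [sup_eq_right.2 h]
      have hy := Real.sqrt_nonneg (partialSups x n)
      have hyz := Real.sqrt_le_sqrt h
      have hz := Real.sq_sqrt (hx (n + 1))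
      set y := √(partialSups x n)
      set z := √(x (n + 1))
      have key : z ^ 3 - y ^ 3 ≤ 3 * ((z - y) * x (n + 1)) := by
        rw [← hz]
        nlinarith [mul_nonneg (sub_nonneg.2 hyz) (mul_nonneg (sub_nonneg.2 hyz) hy),
          mul_nonneg (sub_nonneg.2 hyz) (mul_nonneg (sub_nonneg.2 hyz) (hy.trans hyz))]
      linarith

/-- **Doob's maximal inequality** with exponent `3/2` for nonnegative discrete martingales. -/
theorem MeasureTheory.Martingale.integral_sqrt_partialSups_pow_three_le {Ω : Type*}
    {mΩ : MeasurableSpace Ω} {P : Measure Ω} [IsFiniteMeasure P] {𝒢 : Filtration ℕ mΩ}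
    {X : ℕ → Ω → ℝ} (hX : Martingale X 𝒢 P) (h0 : ∀ᵐ ω ∂P, ∀ k, 0 ≤ X k ω)
    (hint : ∀ k, Integrable (fun ω => √(X k ω) ^ 3) P) (n : ℕ) :
    Integrable (fun ω => √(partialSups (fun k => X k ω) n) ^ 3) P ∧
      ∫ ω, √(partialSups (fun k => X k ω) n) ^ 3 ∂P ≤ 6 * ∫ ω, √(X n ω) ^ 3 ∂P := by
  have hmeas : ∀ k, StronglyMeasurable[𝒢 k] (fun ω => √(partialSups (fun k => X k ω) k)) :=
    fun k => Real.continuous_sqrt.comp_stronglyMeasurable (stronglyMeasurable_partialSups hX.1 k)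
  have hmeas' := fun k => (hmeas k).mono (𝒢.le k)
  have hXm : ∀ k, StronglyMeasurable (X k) := fun k => (hX.1 k).mono (𝒢.le k)
  have hS : ∀ n, Integrable (fun ω => √(partialSups (fun k => X k ω) n) ^ 3) P := by
    intro n
    induction n with
    | zero => simpa using hint 0
    | succ n ih =>
      refine (ih.add (hint (n + 1))).mono' ((hmeas' _).pow 3).aestronglyMeasurable (ae_of_all _ ?_)
      intro ω
      have h1 := pow_nonneg (Real.sqrt_nonneg (partialSups (fun k => X k ω) n)) 3
      have h2 := pow_nonneg (Real.sqrt_nonneg (X (n + 1) ω)) 3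
      rw [Real.norm_of_nonneg (by positivity), partialSups_add_one]
      rcases le_total (X (n + 1) ω) (partialSups (fun k => X k ω) n) with h | h
      · simp only [sup_eq_left.2 h, Pi.add_apply]
        linarith
      · simp only [sup_eq_right.2 h, Pi.add_apply]
        linarith
  have hprod : ∀ i j, Integrable (fun ω => √(partialSups (fun k => X k ω) i) * X j ω) P := by
    intro i j
    refine (hS (max i j)).mono' ((hmeas' i).mul (hXm j)).aestronglyMeasurable ?_
    filter_upwards [h0] with ω hω
    rw [Real.norm_of_nonneg (mul_nonneg (Real.sqrt_nonneg _) (hω j))]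
    have h1 := Real.sqrt_le_sqrt ((partialSups_monotone (fun k => X k ω)) (le_max_left i j))
    have h2 : X j ω ≤ partialSups (fun k => X k ω) (max i j) :=
      le_partialSups_of_le (fun k => X k ω) (le_max_right i j)
    have h3 := Real.sq_sqrt ((hω j).trans h2)
    calc _ ≤ √(partialSups (fun k => X k ω) (max i j)) *
          partialSups (fun k => X k ω) (max i j) :=
        mul_le_mul h1 h2 (hω j) (Real.sqrt_nonneg _)
      _ = _ := by nth_rewrite 2 [← h3]; ring
  refine ⟨hS n, ?_⟩
  have hterm : ∀ k, Integrable
      (fun ω => √(partialSups (fun k => X k ω) k) * (X (k + 1) ω - X k ω)) P := by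
    intro k
    simp only [mul_sub]
    exact (hprod k (k + 1)).sub (hprod k k)
  have hsum : ∫ ω, ∑ k ∈ Finset.range n,
      √(partialSups (fun k => X k ω) k) * (X (k + 1) ω - X k ω) ∂P = 0 := by
    rw [integral_finsetSum _ fun k _ => hterm k]
    exact Finset.sum_eq_zero fun k _ =>
      hX.integral_mul_sub_eq_zero k.le_succ (hmeas k) (hterm k)
  have hsumint := integrable_finsetSum (Finset.range n) fun k _ => hterm k
  have hle : ∫ ω, √(partialSups (fun k => X k ω) n) ^ 3 ∂P +
      3 * ∫ ω, ∑ k ∈ Finset.range n,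
        √(partialSups (fun k => X k ω) k) * (X (k + 1) ω - X k ω) ∂P ≤
      ∫ ω, (1 / 2 * √(partialSups (fun k => X k ω) n) ^ 3 + 3 * √(X n ω) ^ 3) ∂P := by
    rw [← integral_const_mul, ← integral_add (hS n) (hsumint.const_mul 3)]
    refine integral_mono_ae ((hS n).add (hsumint.const_mul 3))
      (((hS n).const_mul _).add ((hint n).const_mul _)) ?_
    filter_upwards [h0] with ω hω
    refine (sqrt_partialSups_pow_three_add_sum_le hω n).trans ?_
    have hu := Real.sqrt_nonneg (partialSups (fun k => X k ω) n)
    have hv := Real.sqrt_nonneg (X n ω)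
    have hv2 := Real.sq_sqrt (hω n)
    set u := √(partialSups (fun k => X k ω) n)
    set v := √(X n ω)
    rw [← hv2]
    nlinarith [mul_nonneg hu (sq_nonneg (2 * u - 3 * v)), mul_nonneg hv (sq_nonneg (2 * u - 3 * v)),
      mul_nonneg (add_nonneg hu hv) (sq_nonneg (5 * u - 7 * v))]
  rw [hsum, integral_add ((hS n).const_mul _) ((hint n).const_mul _), integral_const_mul,
    integral_const_mul] at hle
  linarith

theorem sum_abs_sub_le_two_mul {q : ℕ → ℝ} {C : ℝ} (h0 : q 0 = 0) (hC : ∀ k, q k ≤ C)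
    (hmono : ∀ k, q k ≤ q (k + 1) ∨ ∀ j, k + 1 ≤ j → q j = 0) (n : ℕ) :
    ∑ k ∈ Finset.range n, |q (k + 1) - q k| ≤ 2 * C := by
  have hC0 : 0 ≤ C := h0 ▸ hC 0
  have key : (∑ k ∈ Finset.range n, |q (k + 1) - q k| = q n) ∨
      (∑ k ∈ Finset.range n, |q (k + 1) - q k| ≤ 2 * C ∧ ∀ j, n ≤ j → q j = 0) := by
    induction n with
    | zero => simp [h0]
    | succ n ih =>
      rw [Finset.sum_range_succ]
      rcases ih with h | ⟨h, hz⟩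
      · rcases hmono n with hn | hn
        · left
          rw [h, abs_of_nonneg (sub_nonneg.2 hn)]
          ring
        · right
          refine ⟨?_, hn⟩
          have hpos : 0 ≤ q n := h ▸ Finset.sum_nonneg fun _ _ => abs_nonneg _
          rw [h, hn (n + 1) le_rfl, zero_sub, abs_neg, abs_of_nonneg hpos]
          linarith [hC n]
      · right
        refine ⟨?_, fun j hj => hz j (by lia)⟩
        rw [hz n le_rfl, hz (n + 1) n.le_succ]
        simpa using h
  rcases key with h | h
  · linarith [hC n]
  · exact h.1

/-- The largest absolute increment of the sequence `m` up to index `n`. -/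
noncomputable def maxIncrement (m : ℕ → ℝ) (n : ℕ) : ℝ :=
  partialSups (fun k => |m k - m (k - 1)|) n

theorem maxIncrement_zero (m : ℕ → ℝ) : maxIncrement m 0 = 0 := by
  simp [maxIncrement]

theorem maxIncrement_succ (m : ℕ → ℝ) (n : ℕ) :
    maxIncrement m (n + 1) = max (maxIncrement m n) |m (n + 1) - m n| := by
  simp [maxIncrement, partialSups_add_one]

theorem abs_sub_le_maxIncrement (m : ℕ → ℝ) {k n : ℕ} (h : k < n) :
    |m (k + 1) - m k| ≤ maxIncrement m n :=
  le_partialSups_of_le (fun k => |m k - m (k - 1)|) (Nat.succ_le_of_lt h)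

theorem maxIncrement_nonneg (m : ℕ → ℝ) (n : ℕ) : 0 ≤ maxIncrement m n :=
  (abs_nonneg _).trans (le_partialSups_of_le (fun k => |m k - m (k - 1)|) n.zero_le)

theorem maxIncrement_le {m : ℕ → ℝ} {C : ℝ} (h0 : 0 ≤ C) (h : ∀ k, |m (k + 1) - m k| ≤ C) (n : ℕ) :
    maxIncrement m n ≤ C := by
  refine partialSups_le _ _ _ fun j _ => ?_
  rcases j with _ | j
  · simpa using h0
  · exact h j

theorem maxIncrement_le_two_mul {m : ℕ → ℝ} {r : ℝ} (hm : ∀ k, |m k| ≤ r) (n : ℕ) :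
    maxIncrement m n ≤ 2 * r := by
  have hr : 0 ≤ r := (abs_nonneg _).trans (hm 0)
  exact maxIncrement_le (by linarith) (fun k => (abs_sub _ _).trans (by linarith [hm k, hm (k + 1)])) n

theorem stronglyMeasurable_maxIncrement {Ω : Type*} {mΩ : MeasurableSpace Ω}
    {𝒢 : Filtration ℕ mΩ} {X : ℕ → Ω → ℝ} (hX : StronglyAdapted 𝒢 X) (n : ℕ) :
    StronglyMeasurable[𝒢 n] (fun ω => maxIncrement (fun k => X k ω) n) := by
  refine stronglyMeasurable_partialSups (X := fun k ω => |X k ω - X (k - 1) ω|) (fun k => ?_) n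
  exact continuous_abs.comp_stronglyMeasurable
    ((hX k).sub ((hX (k - 1)).mono (𝒢.mono (Nat.sub_le k 1))))

theorem sum_abs_sub_pow_three_le {m : ℕ → ℝ} {r : ℝ} (hm : ∀ k, |m k| ≤ r) (n : ℕ) :
    ∑ k ∈ Finset.range n, |m (k + 1) - m k| ^ 3 ≤
      5 * (maxIncrement m n * r ^ 2) -
        2 * ∑ k ∈ Finset.range n, maxIncrement m k * m k * (m (k + 1) - m k) := by
  suffices h : ∑ k ∈ Finset.range n, |m (k + 1) - m k| ^ 3 ≤
      maxIncrement m n * m n ^ 2 + 4 * r ^ 2 * maxIncrement m n -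
        2 * ∑ k ∈ Finset.range n, maxIncrement m k * m k * (m (k + 1) - m k) by
    have h1 : m n ^ 2 ≤ r ^ 2 := sq_le_sq' (abs_le.1 (hm n)).1 (abs_le.1 (hm n)).2
    nlinarith [mul_le_mul_of_nonneg_left h1 (maxIncrement_nonneg m n)]
  induction n with
  | zero => simp [maxIncrement_zero]
  | succ n ih =>
    rw [Finset.sum_range_succ, Finset.sum_range_succ, maxIncrement_succ]
    have hD := maxIncrement_nonneg m n
    have hd : |m (n + 1) - m n| ≤ 2 * r :=
      (abs_sub _ _).trans (by linarith [hm n, hm (n + 1)])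
    have hsq := sq_abs (m (n + 1) - m n)
    have hd0 := abs_nonneg (m (n + 1) - m n)
    set D := maxIncrement m n
    set a := |m (n + 1) - m n|
    have hb : m (n + 1) ^ 2 = m n ^ 2 + 2 * m n * (m (n + 1) - m n) + a ^ 2 := by
      rw [hsq]; ring
    rcases le_total a D with h | h
    · rw [max_eq_left h, hb]
      nlinarith [mul_le_mul_of_nonneg_right h (sq_nonneg a)]
    · rw [max_eq_right h]
      have h4 : a ^ 2 ≤ 4 * r ^ 2 := by nlinarith
      have h5 := mul_le_mul_of_nonneg_left h4 (sub_nonneg.2 h)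
      have h6 := mul_nonneg (sub_nonneg.2 h) (sq_nonneg (m (n + 1)))
      have h7 : a * m (n + 1) ^ 2 = (a - D) * m (n + 1) ^ 2 +
          D * (m n ^ 2 + 2 * m n * (m (n + 1) - m n) + a ^ 2) := by rw [← hb]; ring
      nlinarith

theorem three_mul_sub_pow_three_add_sum_eq {m q : ℕ → ℝ} (hm : m 0 = 0) (n : ℕ) :
    3 * (m n * q n) - m n ^ 3 + ∑ k ∈ Finset.range n,
        (3 * (m k * ((m (k + 1) ^ 2 - q (k + 1)) - (m k ^ 2 - q k))) -
          3 * ((q k + m k ^ 2) * (m (k + 1) - m k))) =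
      ∑ k ∈ Finset.range n,
        (3 * ((m (k + 1) - m k) * (q (k + 1) - q k)) - (m (k + 1) - m k) ^ 3) := by
  induction n with
  | zero => simp [hm]
  | succ n ih =>
    rw [Finset.sum_range_succ, Finset.sum_range_succ, ← ih]
    ring

/-- Discrete approximate form of `E[M [M]] = E[M³] / 3`. -/
theorem abs_integral_three_mul_sub_pow_three_le {Ω : Type*} {mΩ : MeasurableSpace Ω}
    {P : Measure Ω} [IsFiniteMeasure P] {𝒢 : Filtration ℕ mΩ} {M Q : ℕ → Ω → ℝ} {r : Ω → ℝ}
    (hM : Martingale M 𝒢 P) (hQ : Martingale (fun k ω => M k ω ^ 2 - Q k ω) 𝒢 P)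
    (hM0 : ∀ ω, M 0 ω = 0) (hQ0 : ∀ ω, Q 0 ω = 0)
    (hQmono : ∀ ω k, Q k ω ≤ Q (k + 1) ω ∨ ∀ j, k + 1 ≤ j → Q j ω = 0)
    (hQnn : ∀ ω k, 0 ≤ Q k ω)
    (hr : AEStronglyMeasurable r P) (hr3 : Integrable (fun ω => r ω ^ 3) P)
    (hMr : ∀ᵐ ω ∂P, ∀ k, |M k ω| ≤ r ω) (hQr : ∀ᵐ ω ∂P, ∀ k, Q k ω ≤ 2 * r ω ^ 2) (n : ℕ) :
    |∫ ω, (3 * (M n ω * Q n ω) - M n ω ^ 3) ∂P| ≤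
      17 * ∫ ω, maxIncrement (fun k => M k ω) n * r ω ^ 2 ∂P := by
  have hQm : ∀ k, StronglyMeasurable[𝒢 k] (Q k) := fun k => by
    have : Q k = fun ω => M k ω ^ 2 - (M k ω ^ 2 - Q k ω) := by ext; ring
    rw [this]
    exact ((hM.1 k).pow 2).sub (hQ.1 k)
  have hMm' := fun k => (hM.1 k).mono (𝒢.le k)
  have hQm' := fun k => (hQm k).mono (𝒢.le k)
  have hDm := fun k => stronglyMeasurable_maxIncrement hM.1 k
  have hDm' := fun k => (hDm k).mono (𝒢.le k)
  have hrpos : ∀ᵐ ω ∂P, 0 ≤ r ω := hMr.mono fun ω h => (abs_nonneg _).trans (h 0)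
  have hMM : ∀ i, ∀ᵐ ω ∂P, M i ω ^ 2 ≤ r ω ^ 2 := fun i => by
    filter_upwards [hMr] with ω h
    exact sq_le_sq' (abs_le.1 (h i)).1 (abs_le.1 (h i)).2
  have hmul : ∀ (w : Ω → ℝ) (j : ℕ), StronglyMeasurable w → (∀ᵐ ω ∂P, |w ω| ≤ 3 * r ω ^ 2) →
      Integrable (fun ω => w ω * M j ω) P := by
    intro w j hw hwr
    refine (hr3.const_mul 3).mono' (hw.mul (hMm' j)).aestronglyMeasurable ?_
    filter_upwards [hMr, hwr, hrpos] with ω h1 h2 h3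
    rw [Real.norm_eq_abs, abs_mul]
    calc |w ω| * |M j ω| ≤ 3 * r ω ^ 2 * r ω := mul_le_mul h2 (h1 j) (abs_nonneg _) (by positivity)
      _ = _ := by ring
  have hint1 : ∀ i j, Integrable (fun ω => M i ω * (M j ω ^ 2 - Q j ω)) P := by
    intro i j
    refine (hmul (fun ω => M j ω ^ 2 - Q j ω) i (((hMm' j).pow 2).sub (hQm' j)) ?_).congr
      (ae_of_all _ fun ω => mul_comm _ _)
    filter_upwards [hMM j, hQr] with ω h1 h2
    rw [abs_le]
    constructor <;> nlinarith [hQnn ω j, h2 j, sq_nonneg (M j ω)]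
  have hint2 : ∀ i j, Integrable (fun ω => (Q i ω + M i ω ^ 2) * M j ω) P := by
    intro i j
    refine hmul _ j ((hQm' i).add ((hMm' i).pow 2)) ?_
    filter_upwards [hMM i, hQr] with ω h1 h2
    rw [abs_le]
    constructor <;> nlinarith [hQnn ω i, h2 i, sq_nonneg (M i ω)]
  have hint3 : ∀ i j, Integrable
      (fun ω => maxIncrement (fun k => M k ω) i * M i ω * M j ω) P := by
    intro i j
    refine hmul _ j ((hDm' i).mul (hMm' i)) ?_
    filter_upwards [hMr, hrpos] with ω h1 h2
    rw [abs_mul, abs_of_nonneg (maxIncrement_nonneg _ _)]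
    calc _ ≤ 2 * r ω * r ω :=
          mul_le_mul (maxIncrement_le_two_mul h1 i) (h1 i) (abs_nonneg _) (by positivity)
      _ ≤ _ := by nlinarith [sq_nonneg (r ω)]
  have hintMQ : Integrable (fun ω => 3 * (M n ω * Q n ω) - M n ω ^ 3) P := by
    refine ((hint2 n n).const_mul 3 |>.sub ((hmul (fun ω => M n ω ^ 2) n ((hMm' n).pow 2)
      ?_).const_mul 4)).congr (ae_of_all _ fun ω => ?_)
    · filter_upwards [hMM n] with ω h
      rw [abs_of_nonneg (sq_nonneg _)]
      nlinarith [sq_nonneg (r ω)]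
    · simp only [Pi.sub_apply]
      ring
  have hI1 : ∀ k, Integrable (fun ω => M k ω *
      ((M (k + 1) ω ^ 2 - Q (k + 1) ω) - (M k ω ^ 2 - Q k ω))) P := fun k => by
    simpa only [mul_sub, Pi.sub_def] using (hint1 k (k + 1)).sub (hint1 k k)
  have hI2 : ∀ k, Integrable (fun ω => (Q k ω + M k ω ^ 2) * (M (k + 1) ω - M k ω)) P := fun k => by
    simpa only [mul_sub, Pi.sub_def] using (hint2 k (k + 1)).sub (hint2 k k)
  have hI3 : ∀ k, Integrable (fun ω => maxIncrement (fun k => M k ω) k * M k ω *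
      (M (k + 1) ω - M k ω)) P := fun k => by
    simpa only [mul_sub, Pi.sub_def] using (hint3 k (k + 1)).sub (hint3 k k)
  have hI12 : ∀ k, Integrable (fun ω => 3 * (M k ω *
      ((M (k + 1) ω ^ 2 - Q (k + 1) ω) - (M k ω ^ 2 - Q k ω))) -
      3 * ((Q k ω + M k ω ^ 2) * (M (k + 1) ω - M k ω))) P := fun k =>
    ((hI1 k).const_mul 3).sub ((hI2 k).const_mul 3)
  have hI12z : ∀ k, ∫ ω, (3 * (M k ω *
      ((M (k + 1) ω ^ 2 - Q (k + 1) ω) - (M k ω ^ 2 - Q k ω))) -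
      3 * ((Q k ω + M k ω ^ 2) * (M (k + 1) ω - M k ω))) ∂P = 0 := fun k => by
    rw [integral_sub ((hI1 k).const_mul 3) ((hI2 k).const_mul 3), integral_const_mul,
      integral_const_mul, hQ.integral_mul_sub_eq_zero k.le_succ (hM.1 k) (hI1 k),
      hM.integral_mul_sub_eq_zero (w := fun ω => Q k ω + M k ω ^ 2) k.le_succ
        ((hQm k).add ((hM.1 k).pow 2)) (hI2 k)]
    simp
  have hI3z : ∀ k, ∫ ω, maxIncrement (fun k => M k ω) k * M k ω * (M (k + 1) ω - M k ω) ∂P = 0 :=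
    fun k => hM.integral_mul_sub_eq_zero k.le_succ ((hDm k).mul (hM.1 k)) (hI3 k)
  have hDr : Integrable (fun ω => maxIncrement (fun k => M k ω) n * r ω ^ 2) P := by
    refine (hr3.const_mul 2).mono' ((hDm' n).aestronglyMeasurable.mul (hr.pow 2)) ?_
    filter_upwards [hMr] with ω h1
    rw [Real.norm_of_nonneg (mul_nonneg (maxIncrement_nonneg _ _) (sq_nonneg _))]
    calc _ ≤ 2 * r ω * r ω ^ 2 :=
          mul_le_mul_of_nonneg_right (maxIncrement_le_two_mul h1 n) (sq_nonneg _)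
      _ = _ := by ring
  have hs12 := integrable_finsetSum (Finset.range n) fun k _ => hI12 k
  have hs3 := integrable_finsetSum (Finset.range n) fun k _ => hI3 k
  have hz12 := (integral_finsetSum (Finset.range n) fun k _ => hI12 k).trans
    (Finset.sum_eq_zero fun k _ => hI12z k)
  have hz3 := (integral_finsetSum (Finset.range n) fun k _ => hI3 k).trans
    (Finset.sum_eq_zero fun k _ => hI3z k)
  have hL := integral_add hintMQ hs12
  rw [hz12, add_zero] at hL
  have hR := integral_sub (hDr.const_mul 17) (hs3.const_mul 2)
  rw [integral_const_mul, integral_const_mul, hz3, mul_zero, sub_zero] at hR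
  rw [← hL, ← hR]
  refine abs_integral_le_integral_abs.trans (integral_mono_ae (hintMQ.add hs12).abs
    ((hDr.const_mul 17).sub (hs3.const_mul 2)) ?_)
  filter_upwards [hMr, hQr] with ω h1 h2
  have e := three_mul_sub_pow_three_add_sum_eq (m := fun k => M k ω) (q := fun k => Q k ω)
    (hM0 ω) n
  have hcube := sum_abs_sub_pow_three_le h1 n
  have hvar := sum_abs_sub_le_two_mul (q := fun k => Q k ω) (hQ0 ω) h2 (hQmono ω) n
  have hD := maxIncrement_nonneg (fun k => M k ω) n
  beta_reduce at e hcube hvar ⊢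
  rw [e]
  have hcross : ∑ k ∈ Finset.range n, |M (k + 1) ω - M k ω| * |Q (k + 1) ω - Q k ω| ≤
      maxIncrement (fun k => M k ω) n * (2 * (2 * r ω ^ 2)) := by
    refine le_trans ?_ (mul_le_mul_of_nonneg_left hvar hD)
    rw [Finset.mul_sum]
    exact Finset.sum_le_sum fun k hk => mul_le_mul_of_nonneg_right
      (abs_sub_le_maxIncrement (fun k => M k ω) (Finset.mem_range.1 hk)) (abs_nonneg _)
  calc _ ≤ ∑ k ∈ Finset.range n, (3 * (|M (k + 1) ω - M k ω| * |Q (k + 1) ω - Q k ω|) +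
        |M (k + 1) ω - M k ω| ^ 3) := by
        refine (Finset.abs_sum_le_sum_abs _ _).trans (Finset.sum_le_sum fun k _ => ?_)
        refine (abs_sub _ _).trans (le_of_eq ?_)
        rw [abs_mul, abs_mul, abs_pow]
        norm_num
    _ ≤ _ := by
        rw [Finset.sum_add_distrib, ← Finset.mul_sum]
        linarith

theorem exists_integrable_ge_of_monotone {Ω : Type*} {mΩ : MeasurableSpace Ω} {P : Measure Ω}
    {g : ℕ → Ω → ℝ} {C : ℝ} (hg : ∀ n, Integrable (g n) P) (hg0 : ∀ n ω, 0 ≤ g n ω)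
    (hmono : ∀ ω, Monotone fun n => g n ω) (hC : ∀ n, ∫ ω, g n ω ∂P ≤ C) :
    ∃ H : Ω → ℝ, Integrable H P ∧ ∀ᵐ ω ∂P, ∀ n, g n ω ≤ H ω := by
  have hm : ∀ n, AEMeasurable (fun ω => ENNReal.ofReal (g n ω)) P :=
    fun n => (hg n).1.aemeasurable.ennreal_ofReal
  have hlt : ∫⁻ ω, ⨆ n, ENNReal.ofReal (g n ω) ∂P ≠ ⊤ := by
    rw [lintegral_iSup' hm (ae_of_all _ fun ω _ _ h => ENNReal.ofReal_le_ofReal (hmono ω h))]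
    refine ne_top_of_le_ne_top (ENNReal.ofReal_ne_top (r := C)) (iSup_le fun n => ?_)
    rw [← ofReal_integral_eq_lintegral_ofReal (hg n) (ae_of_all _ (hg0 n))]
    exact ENNReal.ofReal_le_ofReal (hC n)
  refine ⟨fun ω => (⨆ n, ENNReal.ofReal (g n ω)).toReal,
    integrable_toReal_of_lintegral_ne_top (AEMeasurable.iSup hm) hlt, ?_⟩
  filter_upwards [ae_lt_top' (AEMeasurable.iSup hm) hlt] with ω hω n
  exact (ENNReal.ofReal_le_iff_le_toReal hω.ne).1 (le_iSup (fun n => ENNReal.ofReal (g n ω)) n)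

/-- The `k`-th point of the dyadic grid of level `n` on `[0, T]`, constant equal to `T` once
`k ≥ 2 ^ n`. -/
noncomputable def dyadicTime (T : ℝ) (n k : ℕ) : ℝ := T * min ((k : ℝ) / 2 ^ n) 1

theorem dyadicTime_zero (T : ℝ) (n : ℕ) : dyadicTime T n 0 = 0 := by
  simp [dyadicTime]

theorem dyadicTime_two_pow (T : ℝ) (n : ℕ) : dyadicTime T n (2 ^ n) = T := by
  simp [dyadicTime]

theorem dyadicTime_succ_two_mul (T : ℝ) (n k : ℕ) :
    dyadicTime T (n + 1) (2 * k) = dyadicTime T n k := by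
  have : ((2 * k : ℕ) : ℝ) / 2 ^ (n + 1) = k / 2 ^ n := by
    push_cast
    field_simp
    ring
  rw [dyadicTime, dyadicTime, this]

theorem dyadicTime_monotone {T : ℝ} (hT : 0 ≤ T) (n : ℕ) : Monotone (dyadicTime T n) := by
  intro i j hij
  unfold dyadicTime
  gcongr

theorem dyadicTime_mem {T : ℝ} (hT : 0 ≤ T) (n k : ℕ) : dyadicTime T n k ∈ Set.Icc 0 T :=
  ⟨mul_nonneg hT (by positivity), mul_le_of_le_one_right hT (min_le_right _ _)⟩

theorem abs_dyadicTime_succ_sub_le {T : ℝ} (hT : 0 ≤ T) (n k : ℕ) :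
    |dyadicTime T n (k + 1) - dyadicTime T n k| ≤ T / 2 ^ n := by
  rw [abs_of_nonneg (sub_nonneg.2 (dyadicTime_monotone hT n (Nat.le_add_right k 1))), dyadicTime,
    dyadicTime,
    ← mul_sub, div_eq_mul_inv T, ← one_div]
  refine mul_le_mul_of_nonneg_left ?_ hT
  have h : ((k + 1 : ℕ) : ℝ) / 2 ^ n = k / 2 ^ n + 1 / 2 ^ n := by push_cast; ring
  have hp : (0 : ℝ) ≤ 1 / 2 ^ n := by positivity
  rw [h]
  rcases le_total ((k : ℝ) / 2 ^ n) 1 with h1 | h1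
  · rw [min_eq_left h1]
    linarith [min_le_left ((k : ℝ) / 2 ^ n + 1 / 2 ^ n) 1]
  · rw [min_eq_right h1]
    linarith [min_le_right ((k : ℝ) / 2 ^ n + 1 / 2 ^ n) 1]

theorem tendsto_maxIncrement_dyadicTime {T : ℝ} (hT : 0 ≤ T) {m : ℝ → ℝ} (hm : Continuous m) :
    Filter.Tendsto (fun n => maxIncrement (fun k => m (dyadicTime T n k)) (2 ^ n)) Filter.atTop
      (nhds 0) := by
  rw [Metric.tendsto_atTop]
  intro ε hε
  obtain ⟨δ, hδ, h⟩ := Metric.uniformContinuousOn_iff.1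
    (isCompact_Icc.uniformContinuousOn_of_continuous (s := Set.Icc 0 T) hm.continuousOn)
    (ε / 2) (half_pos hε)
  have hlim : Filter.Tendsto (fun n : ℕ => T / 2 ^ n) Filter.atTop (nhds 0) := by
    simpa [div_eq_mul_inv] using
      (tendsto_pow_atTop_nhds_zero_of_lt_one (r := (2⁻¹ : ℝ)) (by norm_num) (by norm_num)).const_mul T
  obtain ⟨N, hN⟩ := Filter.eventually_atTop.1 (hlim.eventually_lt_const hδ)
  refine ⟨N, fun n hn => ?_⟩
  rw [Real.dist_eq, sub_zero, abs_of_nonneg (maxIncrement_nonneg _ _)]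
  refine lt_of_le_of_lt (maxIncrement_le (half_pos hε).le (fun k => ?_) _) (half_lt_self hε)
  exact (h _ (dyadicTime_mem hT n (k + 1)) _ (dyadicTime_mem hT n k)
    ((abs_dyadicTime_succ_sub_le hT n k).trans_lt (hN n hn))).le

/-- A nonnegative `L^{3/2}` martingale `X` on `[0, T]` admits an `L^{3/2}` bound along all dyadic
times, written here as the square of an `L³` function. -/
theorem MeasureTheory.Martingale.exists_sqrt_dyadicTime_le {Ω : Type*} {mΩ : MeasurableSpace Ω}
    {P : Measure Ω} [IsFiniteMeasure P] {ℱ : Filtration ℝ mΩ} {T : ℝ} (hT : 0 ≤ T)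
    {X : ℝ → Ω → ℝ} (hX : Martingale X ℱ P) (h0 : ∀ t, ∀ᵐ ω ∂P, 0 ≤ X t ω)
    (hint : ∀ t, Integrable (fun ω => √(X t ω) ^ 3) P) :
    ∃ r : Ω → ℝ, AEStronglyMeasurable r P ∧ Integrable (fun ω => r ω ^ 3) P ∧
      ∀ᵐ ω ∂P, ∀ n k, √(X (dyadicTime T n k) ω) ≤ r ω := by
  have hdoob := fun n => (hX.comp_monotone (dyadicTime_monotone hT n)
    ).integral_sqrt_partialSups_pow_three_le (ae_all_iff.2 fun k => h0 _) (fun k => hint _) (2 ^ n)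
  obtain ⟨H, hH, hle⟩ := exists_integrable_ge_of_monotone
    (g := fun n ω => √(partialSups (fun k => X (dyadicTime T n k) ω) (2 ^ n)) ^ 3)
    (C := 6 * ∫ ω, √(X T ω) ^ 3 ∂P) (fun n => (hdoob n).1) (fun n ω => by positivity)
    (fun ω => monotone_nat_of_le_succ fun n => by
      refine pow_le_pow_left₀ (Real.sqrt_nonneg _) (Real.sqrt_le_sqrt ?_) 3
      refine partialSups_le _ _ _ fun j hj => ?_
      rw [← dyadicTime_succ_two_mul]
      exact le_partialSups_of_le (fun k => X (dyadicTime T (n + 1) k) ω)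
        (by rw [pow_succ]; lia))
    (fun n => by simpa only [dyadicTime_two_pow] using (hdoob n).2)
  have hH0 : ∀ᵐ ω ∂P, 0 ≤ H ω := hle.mono fun ω h => le_trans (by positivity) (h 0)
  have hcube : ∀ᵐ ω ∂P, (H ω ^ (1 / 3 : ℝ)) ^ 3 = H ω := hH0.mono fun ω h => by
    rw [← Real.rpow_natCast, ← Real.rpow_mul h]
    norm_num
  refine ⟨fun ω => H ω ^ (1 / 3 : ℝ),
    (hH.1.aemeasurable.pow_const _).aestronglyMeasurable,
    hH.congr (hcube.mono fun ω h => h.symm), ?_⟩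
  filter_upwards [hle, hcube, hH0] with ω h1 h2 h3 n k
  refine le_of_pow_le_pow_left₀ three_ne_zero (by positivity) ?_
  rw [h2]
  refine le_trans ?_ (h1 n)
  refine pow_le_pow_left₀ (Real.sqrt_nonneg _) (Real.sqrt_le_sqrt ?_) 3
  rcases le_total k (2 ^ n) with hk | hk
  · exact le_partialSups_of_le (fun k => X (dyadicTime T n k) ω) hk
  · have : dyadicTime T n k = dyadicTime T n (2 ^ n) := by
      refine le_antisymm ?_ (dyadicTime_monotone hT n hk)
      rw [dyadicTime_two_pow]
      exact (dyadicTime_mem hT n k).2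
    rw [this]
    exact le_partialSups_of_le (fun k => X (dyadicTime T n k) ω) le_rfl

theorem integral_sq_le_integral_sq_or_eq_zero (g : ℝ → ℝ) {s t : ℝ} (hs : 0 ≤ s) (hst : s ≤ t) :
    (∫ x in (0:ℝ)..s, g x ^ 2) ≤ (∫ x in (0:ℝ)..t, g x ^ 2) ∨
      ∀ u, t ≤ u → ∫ x in (0:ℝ)..u, g x ^ 2 = 0 := by
  by_cases h : IntervalIntegrable (fun x => g x ^ 2) volume 0 t
  · exact .inl (intervalIntegral.integral_mono_interval le_rfl hs hst
      (ae_of_all _ fun x => sq_nonneg _) h)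
  · refine .inr fun u hu => intervalIntegral.integral_undef fun hu' => h (hu'.mono_set ?_)
    rw [Set.uIcc_of_le (hs.trans hst), Set.uIcc_of_le ((hs.trans hst).trans hu)]
    exact Set.Icc_subset_Icc_right hu

theorem sqrt_pow_three {x : ℝ} (hx : 0 ≤ x) : √x ^ 3 = x ^ ((3:ℝ) / 2) := by
  rw [Real.sqrt_eq_rpow, ← Real.rpow_natCast, ← Real.rpow_mul hx]
  norm_num

theorem memLp_three_halves_of_integrable {Ω : Type*} {mΩ : MeasurableSpace Ω} {P : Measure Ω}
    {Y : Ω → ℝ} (hY : AEStronglyMeasurable Y P) (hint : Integrable (fun ω => |Y ω| ^ ((3:ℝ) / 2)) P) :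
    MemLp Y (ENNReal.ofReal (3 / 2)) P := by
  rw [← integrable_norm_rpow_iff hY (by simp) ENNReal.ofReal_ne_top,
    ENNReal.toReal_ofReal (by norm_num)]
  simpa only [Real.norm_eq_abs] using hint

/-- Maximal bounds for a martingale `M` and for `Q` such that `M² - Q` is a martingale. -/
theorem exists_dyadicTime_bound {Ω : Type*} {mΩ : MeasurableSpace Ω}
    {P : Measure Ω} [IsFiniteMeasure P] {ℱ : Filtration ℝ mΩ} {T : ℝ} (hT : 0 ≤ T)
    {M Q : ℝ → Ω → ℝ} (hM : Martingale M ℱ P)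
    (hQ : Martingale (fun t ω => M t ω ^ 2 - Q t ω) ℱ P)
    (hM2 : MemLp (fun ω => M T ω ^ 2) (ENNReal.ofReal (3 / 2)) P)
    (hQ2 : MemLp (Q T) (ENNReal.ofReal (3 / 2)) P) :
    ∃ r : Ω → ℝ, AEStronglyMeasurable r P ∧ Integrable (fun ω => r ω ^ 3) P ∧
      ∀ᵐ ω ∂P, ∀ n k, |M (dyadicTime T n k) ω| ≤ r ω ∧ Q (dyadicTime T n k) ω ≤ 2 * r ω ^ 2 := by
  have hp : (1 : ENNReal) ≤ ENNReal.ofReal (3 / 2) := by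
    rw [← ENNReal.ofReal_one]
    exact ENNReal.ofReal_le_ofReal (by norm_num)
  let Z : ℝ → Ω → ℝ := fun t ω => M t ω ^ 2 - Q t ω
  let Y : Ω → ℝ := fun ω => M T ω ^ 2 + |Z T ω|
  have hZ : MemLp (Z T) (ENNReal.ofReal (3 / 2)) P := hM2.sub hQ2
  have hY : MemLp Y (ENNReal.ofReal (3 / 2)) P := hM2.add hZ.abs
  have hYint : Integrable Y P := hY.integrable hp
  have hM2int := hM2.integrable hp
  have hX : Martingale (fun t => P[Y | ℱ t]) ℱ P := martingale_condExp Y ℱ P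
  have hX0 : ∀ t, ∀ᵐ ω ∂P, 0 ≤ (P[Y | ℱ t]) ω := fun t =>
    condExp_nonneg (ae_of_all _ fun ω => add_nonneg (sq_nonneg _) (abs_nonneg _))
  have hXint : ∀ t, Integrable (fun ω => √((P[Y | ℱ t]) ω) ^ 3) P := fun t => by
    have h := ((hY.condExp (m := ℱ t) hp).integrable_norm_rpow (by simp) ENNReal.ofReal_ne_top)
    rw [ENNReal.toReal_ofReal (by norm_num)] at h
    refine h.congr ((hX0 t).mono fun ω hω => ?_)
    simp only [Real.norm_of_nonneg hω, sqrt_pow_three hω]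
  obtain ⟨r, hr, hr3, hbound⟩ := hX.exists_sqrt_dyadicTime_le hT hX0 hXint
  refine ⟨r, hr, hr3, ?_⟩
  have hMX : ∀ t ≤ T, ∀ᵐ ω ∂P, M t ω ^ 2 ≤ (P[Y | ℱ t]) ω := fun t ht => by
    have hj := ConvexOn.map_condExp_le_univ (φ := fun x : ℝ => x ^ 2) (f := M T) (μ := P)
      (ℱ.le t) even_two.convexOn_pow (continuous_pow 2).lowerSemicontinuous (hM.integrable T) hM2int
    have hm := condExp_mono (m := ℱ t) hM2int hYint
      (ae_of_all _ fun ω => le_add_of_nonneg_right (abs_nonneg _))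
    filter_upwards [hj, hm, hM.2 t T ht] with ω h1 h2 h3
    rw [← h3]
    exact h1.trans h2
  have hZX : ∀ t ≤ T, ∀ᵐ ω ∂P, |Z t ω| ≤ (P[Y | ℱ t]) ω := fun t ht => by
    have hm := condExp_mono (m := ℱ t) (hZ.integrable hp).abs hYint
      (ae_of_all _ fun ω => le_add_of_nonneg_left (sq_nonneg _))
    filter_upwards [abs_condExp_ae_le_condExp_abs (m := ℱ t) (μ := P) (Z T), hm, hQ.2 t T ht]
      with ω h1 h2 h3
    have h3' : (P[Z T | ℱ t]) ω = Z t ω := h3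
    rw [← h3']
    exact h1.trans h2
  have hall : ∀ᵐ ω ∂P, ∀ n k, M (dyadicTime T n k) ω ^ 2 ≤ (P[Y | ℱ (dyadicTime T n k)]) ω ∧
      |Z (dyadicTime T n k) ω| ≤ (P[Y | ℱ (dyadicTime T n k)]) ω :=
    ae_all_iff.2 fun n => ae_all_iff.2 fun k =>
      (hMX _ (dyadicTime_mem hT n k).2).and (hZX _ (dyadicTime_mem hT n k).2)
  filter_upwards [hbound, hall] with ω h1 h2 n k
  obtain ⟨h3, h4⟩ := h2 n k
  have h5 := h1 n k
  have h6 : (P[Y | ℱ (dyadicTime T n k)]) ω ≤ r ω ^ 2 :=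
    (Real.sqrt_le_left ((Real.sqrt_nonneg _).trans h5)).1 h5
  refine ⟨(Real.abs_le_sqrt h3).trans h5, ?_⟩
  have h7 : Q (dyadicTime T n k) ω = M (dyadicTime T n k) ω ^ 2 - Z (dyadicTime T n k) ω := by
    simp only [Z]
    ring
  linarith [neg_abs_le (Z (dyadicTime T n k) ω)]

/-- `E[M_T Q_T] = E[M_T³] / 3` for a continuous martingale `M` such that `M² - Q` is a martingale,
where the paths of `Q` are nondecreasing except possibly for a final drop to zero. -/
theorem integral_mul_eq_third_integral_pow_three {Ω : Type*} {mΩ : MeasurableSpace Ω}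
    {P : Measure Ω} [IsFiniteMeasure P] {ℱ : Filtration ℝ mΩ} {T : ℝ} (hT : 0 ≤ T)
    {M Q : ℝ → Ω → ℝ} (hM : Martingale M ℱ P)
    (hcont : ∀ ω, Continuous fun t => M t ω)
    (hQ : Martingale (fun t ω => M t ω ^ 2 - Q t ω) ℱ P)
    (hM0 : ∀ ω, M 0 ω = 0) (hQ0 : ∀ ω, Q 0 ω = 0) (hQnn : ∀ ω t, 0 ≤ t → 0 ≤ Q t ω)
    (hQmono : ∀ ω s t, 0 ≤ s → s ≤ t → Q s ω ≤ Q t ω ∨ ∀ u, t ≤ u → Q u ω = 0)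
    (hM2 : MemLp (fun ω => M T ω ^ 2) (ENNReal.ofReal (3 / 2)) P)
    (hQ2 : MemLp (Q T) (ENNReal.ofReal (3 / 2)) P)
    (hMQ : Integrable (fun ω => M T ω * Q T ω) P) (hM3 : Integrable (fun ω => M T ω ^ 3) P) :
    ∫ ω, M T ω * Q T ω ∂P = (1 / 3) * ∫ ω, M T ω ^ 3 ∂P := by
  obtain ⟨r, hr, hr3, hbound⟩ := exists_dyadicTime_bound hT hM hQ hM2 hQ2
  have hdisc := fun n => by
    have hmono := dyadicTime_monotone hT n
    have hpos := fun k => (dyadicTime_mem hT n k).1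
    have h := abs_integral_three_mul_sub_pow_three_le (r := r) (hM.comp_monotone hmono)
      (Q := fun k => Q (dyadicTime T n k)) (hQ.comp_monotone hmono)
      (fun ω => by rw [dyadicTime_zero]; exact hM0 ω)
      (fun ω => by rw [dyadicTime_zero]; exact hQ0 ω)
      (fun ω k => (hQmono ω _ _ (hpos k) (hmono k.le_succ)).imp_right
        fun h j hj => h _ (hmono hj))
      (fun ω k => hQnn ω _ (hpos k)) hr hr3
      (hbound.mono fun ω h k => (h n k).1) (hbound.mono fun ω h k => (h n k).2) (2 ^ n)
    rwa [dyadicTime_two_pow] at h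
  have hlim : Filter.Tendsto (fun n : ℕ => 17 * ∫ ω,
      maxIncrement (fun k => M (dyadicTime T n k) ω) (2 ^ n) * r ω ^ 2 ∂P) Filter.atTop
      (nhds (17 * ∫ _, (0 : ℝ) ∂P)) := by
    refine (tendsto_integral_of_dominated_convergence (fun ω => 2 * r ω ^ 3) (fun n => ?_)
      (hr3.const_mul 2) (fun n => ?_) (ae_of_all _ fun ω => ?_)).const_mul 17
    · have hm := hM.comp_monotone (dyadicTime_monotone hT n)
      exact ((stronglyMeasurable_maxIncrement hm.1 (2 ^ n)).mono
        (ℱ.le _)).aestronglyMeasurable.mul (hr.pow 2)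
    · filter_upwards [hbound] with ω h
      rw [Real.norm_of_nonneg (mul_nonneg (maxIncrement_nonneg _ _) (sq_nonneg _))]
      calc _ ≤ 2 * r ω * r ω ^ 2 := mul_le_mul_of_nonneg_right
            (maxIncrement_le_two_mul (fun k => (h n k).1) _) (sq_nonneg _)
        _ = _ := by ring
    · simpa using (tendsto_maxIncrement_dyadicTime hT (hcont ω)).mul_const (r ω ^ 2)
  rw [integral_zero, mul_zero] at hlim
  have hzero := abs_nonpos_iff.1 (ge_of_tendsto' hlim hdisc)
  rw [integral_sub (hMQ.const_mul 3) hM3, integral_const_mul] at hzero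
  linarith

theorem abs_integral_mul_le_sqrt_mul_sqrt {Ω : Type*} {mΩ : MeasurableSpace Ω} {P : Measure Ω}
    {X Y : Ω → ℝ} (hX : MemLp X 2 P) (hY : MemLp Y 2 P) :
    |∫ ω, X ω * Y ω ∂P| ≤ √(∫ ω, Y ω ^ 2 ∂P) * √(∫ ω, X ω ^ 2 ∂P) := by
  have h := integral_mul_norm_le_Lp_mul_Lq (μ := P) (f := X) (g := Y) Real.HolderConjugate.two_two
    (by simpa using hX) (by simpa using hY)
  refine (abs_integral_le_integral_abs.trans_eq (by simp [abs_mul])).trans (h.trans_eq ?_)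
  simp [Real.sqrt_eq_rpow, mul_comm]

/-- For the continuous martingale `M_t = ∫₀ᵗ f(s) dW_s` with quadratic variation
`[M]_t = ∫₀ᵗ f(s)² ds` (characterized by `M² - [M]` being a martingale), assuming
`E|M_T|³ < ∞` and `E[([M]_T)^{3/2}] < ∞`, one has
`E[M_T [M]_T] = (1/3) E[M_T³]` and `|E[M_T [M]_T]| ≤ √(E[[M]_T²]) √(E[[M]_T])`. -/
theorem stmt_19 {Ω : Type*} {mΩ : MeasurableSpace Ω} (P : Measure Ω) [IsProbabilityMeasure P]
    (ℱ : Filtration ℝ mΩ) (T : ℝ) (hT : 0 < T)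
    (f : Ω → ℝ → ℝ) (M : ℝ → Ω → ℝ)
    (hM : Martingale M ℱ P)
    (hcont : ∀ ω, Continuous fun t => M t ω)
    (hM0 : ∀ ω, M 0 ω = 0)
    (hQV : Martingale (fun t ω => (M t ω)^2 - ∫ s in (0:ℝ)..t, (f ω s)^2) ℱ P)
    (hL3 : Integrable (fun ω => |M T ω|^3) P)
    (hQ32 : Integrable (fun ω => (∫ s in (0:ℝ)..T, (f ω s)^2)^((3:ℝ)/2)) P)
    (hQ2 : Integrable (fun ω => (∫ s in (0:ℝ)..T, (f ω s)^2)^2) P)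
    (hMQ : Integrable (fun ω => M T ω * ∫ s in (0:ℝ)..T, (f ω s)^2) P) :
    (∫ ω, (M T ω * ∫ s in (0:ℝ)..T, (f ω s)^2) ∂P = (1/3) * ∫ ω, (M T ω)^3 ∂P) ∧
    |∫ ω, (M T ω * ∫ s in (0:ℝ)..T, (f ω s)^2) ∂P| ≤
      Real.sqrt (∫ ω, (∫ s in (0:ℝ)..T, (f ω s)^2)^2 ∂P) *
        Real.sqrt (∫ ω, (∫ s in (0:ℝ)..T, (f ω s)^2) ∂P) := by
  have hQnn : ∀ ω t, 0 ≤ t → 0 ≤ ∫ s in (0:ℝ)..t, (f ω s)^2 := fun ω t ht =>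
    intervalIntegral.integral_nonneg ht fun _ _ => sq_nonneg _
  have hMm : StronglyMeasurable (M T) := (hM.1 T).mono (ℱ.le T)
  have hQm : StronglyMeasurable (fun ω => ∫ s in (0:ℝ)..T, (f ω s)^2) := by
    have h : StronglyMeasurable fun ω =>
        M T ω ^ 2 - ((M T ω)^2 - ∫ s in (0:ℝ)..T, (f ω s)^2) :=
      (hMm.pow 2).sub ((hQV.1 T).mono (ℱ.le T))
    simpa using h
  have hM2 : MemLp (fun ω => M T ω ^ 2) (ENNReal.ofReal (3 / 2)) P := by
    refine memLp_three_halves_of_integrable (hMm.pow 2).aestronglyMeasurable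
      (hL3.congr (ae_of_all _ fun ω => ?_))
    simp only
    rw [abs_of_nonneg (sq_nonneg (M T ω)), ← sqrt_pow_three (sq_nonneg _), Real.sqrt_sq_eq_abs]
  have hQL : MemLp (fun ω => ∫ s in (0:ℝ)..T, (f ω s)^2) (ENNReal.ofReal (3 / 2)) P := by
    refine memLp_three_halves_of_integrable hQm.aestronglyMeasurable
      (hQ32.congr (ae_of_all _ fun ω => ?_))
    simp only
    rw [abs_of_nonneg (hQnn ω T hT.le)]
  have hM3 : Integrable (fun ω => M T ω ^ 3) P := by
    refine hL3.mono' (hMm.pow 3).aestronglyMeasurable (ae_of_all _ fun ω => ?_)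
    rw [Real.norm_eq_abs, abs_pow]
  have hp : (1 : ENNReal) ≤ ENNReal.ofReal (3 / 2) := by
    rw [← ENNReal.ofReal_one]
    exact ENNReal.ofReal_le_ofReal (by norm_num)
  have hM2int := hM2.integrable hp
  refine ⟨integral_mul_eq_third_integral_pow_three (Q := fun t ω => ∫ s in (0:ℝ)..t, (f ω s)^2)
    hT.le hM hcont hQV hM0 (by simp) hQnn
    (fun ω _ _ hs hst => integral_sq_le_integral_sq_or_eq_zero (f ω) hs hst) hM2 hQL hMQ hM3, ?_⟩
  have hiso : ∫ ω, (∫ s in (0:ℝ)..T, (f ω s)^2) ∂P = ∫ ω, M T ω ^ 2 ∂P := by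
    have h := hQV.setIntegral_eq hT.le MeasurableSet.univ
    simp only [Measure.restrict_univ, hM0, intervalIntegral.integral_same] at h
    rw [integral_sub hM2int (hQL.integrable hp)] at h
    simp only [ne_eq, OfNat.ofNat_ne_zero, not_false_eq_true, zero_pow, sub_zero,
      integral_zero] at h
    linarith
  rw [hiso]
  exact abs_integral_mul_le_sqrt_mul_sqrt
    ((memLp_two_iff_integrable_sq hMm.aestronglyMeasurable).2 hM2int)
    ((memLp_two_iff_integrable_sq hQm.aestronglyMeasurable).2 hQ2)
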